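/- Assume the Bressan–Constantin differential relations (see context) and suppose W(ξ₈) = π, W′(ξ₈) = 0, Z(ξ₈) = π, and Z′(ξ₈) = 0 at some point ξ₈ ∈ ℝ. Then ∂^i U(ξ₈) = 0 and ∂^i V(ξ₈) = 0 for i = 1, …, 6; ∂^7 U(ξ₈) = −(45/4) q(ξ₈) W″(ξ₈) Z″(ξ₈)²; ∂^7 V(ξ₈) = −(45/4) q(ξ₈) W″(ξ₈)² Z″(ξ₈); ∂^i y(ξ₈) = 0 for i = 1, …, 8; and ∂^9 y(ξ₈) = (315/2) q(ξ₈) W″(ξ₈)² Z″(ξ₈)². -/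

import Mathlib

open Real

def POrd (x : ℝ) (n : ℕ) (f : ℝ → ℝ) (c : ℝ) : Prop :=
  ContDiff ℝ (⊤ : ℕ∞) f ∧ (∀ i < n, iteratedDeriv i f x = 0) ∧
    iteratedDeriv n f x = c * (n.factorial : ℝ)

theorem POrd.mul {x : ℝ} {m n : ℕ} {f g : ℝ → ℝ} {a b : ℝ}
    (hf : POrd x m f a) (hg : POrd x n g b) :
    POrd x (m + n) (fun t => f t * g t) (a * b) := by
  obtain ⟨f1, f2, f3⟩ := hf
  obtain ⟨g1, g2, g3⟩ := hg
  have L : ∀ k : ℕ, iteratedDeriv k (fun t => f t * g t) x = ∑ i ∈ Finset.range (k + 1),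
      (k.choose i : ℝ) * iteratedDeriv i f x * iteratedDeriv (k - i) g x := by
    intro k
    exact iteratedDeriv_fun_mul (f1.contDiffAt.of_le (by exact_mod_cast le_top))
      (g1.contDiffAt.of_le (by exact_mod_cast le_top))
  refine ⟨f1.mul g1, ?_, ?_⟩
  · intro k hk
    rw [L]
    apply Finset.sum_eq_zero
    intro i hi0
    rw [Finset.mem_range] at hi0
    by_cases h : i < m
    · rw [f2 i h]; ring
    · rw [g2 (k - i) (by omega)]; ring
  · rw [L, Finset.sum_eq_single m]
    · rw [f3, Nat.add_sub_cancel_left, g3, ← Nat.add_choose_mul_factorial_mul_factorial m n, Nat.choose_symm_add]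
      push_cast; ring
    · intro i hi0 hi
      rw [Finset.mem_range] at hi0
      by_cases h : i < m
      · rw [f2 i h]; ring
      · rw [g2 (m + n - i) (by omega)]; ring
    · intro h
      exact absurd (Finset.mem_range.2 (by omega)) h

theorem POrd.two {x : ℝ} {f f' : ℝ → ℝ} {c : ℝ} (h : ContDiff ℝ (⊤ : ℕ∞) f)
    (h0 : f x = 0) (hd : ∀ t, HasDerivAt f (f' t) t) (h1 : f' x = 0)
    (h2 : HasDerivAt f' (2 * c) x) : POrd x 2 f c := by
  have e : deriv f = f' := funext fun t => (hd t).deriv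
  refine ⟨h, ?_, ?_⟩
  · intro i hi
    interval_cases i
    · simpa using h0
    · rw [iteratedDeriv_one, e, h1]
  · rw [iteratedDeriv_succ, iteratedDeriv_one, e, h2.deriv]
    simp [Nat.factorial]; ring

theorem POrd.facts {x : ℝ} {W : ℝ → ℝ} (hW : ContDiff ℝ (⊤ : ℕ∞) W) (h0 : W x = π)
    (h1 : deriv W x = 0) :
    POrd x 2 (fun t => Real.sin (W t)) (-(iteratedDeriv 2 W x) / 2) ∧
    POrd x 4 (fun t => Real.cos (W t / 2) ^ 2) ((iteratedDeriv 2 W x) ^ 2 / 16) := by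
  have d1 : ∀ t, HasDerivAt W (deriv W t) t := fun t =>
    ((hW.differentiable (by simp)) t).hasDerivAt
  have d2 : HasDerivAt (deriv W) (iteratedDeriv 2 W x) x := by
    rw [iteratedDeriv_succ, iteratedDeriv_one]
    have : ContDiff ℝ (⊤ : ℕ∞) (deriv W) := (contDiff_infty_iff_deriv.1 hW).2
    exact ((this.differentiable (by simp)) x).hasDerivAt
  constructor
  · refine POrd.two (f' := fun t => Real.cos (W t) * deriv W t) (Real.contDiff_sin.comp hW)
      (by simp [h0]) (fun t => (d1 t).sin) (by simp [h1]) ?_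
    refine (((d1 x).cos).fun_mul d2).congr_deriv ?_
    simp [h0, h1]; ring
  · have A : POrd x 2 (fun t => Real.cos (W t / 2)) (-(iteratedDeriv 2 W x) / 4) := by
      refine POrd.two (f' := fun t => -Real.sin (W t / 2) * (deriv W t / 2))
        (Real.contDiff_cos.comp (hW.div_const 2))
        (by simp [h0]) (fun t => ((d1 t).div_const 2).cos) (by simp [h1]) ?_
      refine ((((d1 x).div_const 2).sin.fun_neg).fun_mul (d2.div_const 2)).congr_deriv ?_
      simp [h0, h1]; ring
    have := A.mul A
    convert this using 1
    · funext t; ring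
    · ring

theorem POrd.fin {x : ℝ} {n : ℕ} {F f : ℝ → ℝ} {c : ℝ} (h : POrd x n f c)
    (hd : ∀ t, deriv F t = f t) :
    (∀ i : ℕ, 1 ≤ i → i ≤ n → iteratedDeriv i F x = 0) ∧
      iteratedDeriv (n + 1) F x = c * (n.factorial : ℝ) := by
  have e : deriv F = f := funext hd
  refine ⟨?_, by rw [iteratedDeriv_succ', e, h.2.2]⟩
  intro i h1 h2
  obtain ⟨j, rfl⟩ : ∃ j, i = j + 1 := ⟨i - 1, by omega⟩
  rw [iteratedDeriv_succ', e, h.2.1 j (by omega)]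

/-- Case (8) of the proof of Theorem 1.2: at a point `ξ₈` with
`W ξ₈ = π`, `W′ ξ₈ = 0`, `Z ξ₈ = π` and `Z′ ξ₈ = 0`:
`∂^i U = ∂^i V = 0` for `i = 1,…,6`,
`∂^7 U = -(45/4) q W″ (Z″)²`, `∂^7 V = -(45/4) q (W″)² Z″`,
`∂^i y = 0` for `i = 1,…,8`, and `∂^9 y = (315/2) q (W″)² (Z″)²` at `ξ₈`. -/
theorem stmt14 (q W Z U V y : ℝ → ℝ)
    (hq : ContDiff ℝ (⊤ : ℕ∞) q) (hW : ContDiff ℝ (⊤ : ℕ∞) W) (hZ : ContDiff ℝ (⊤ : ℕ∞) Z)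
    (hy : ∀ ξ, deriv y ξ = q ξ * Real.cos (W ξ / 2) ^ 2 * Real.cos (Z ξ / 2) ^ 2)
    (hU : ∀ ξ, deriv U ξ = q ξ / 2 * Real.sin (W ξ) * Real.cos (Z ξ / 2) ^ 2)
    (hV : ∀ ξ, deriv V ξ = q ξ / 2 * Real.cos (W ξ / 2) ^ 2 * Real.sin (Z ξ))
    (ξ₈ : ℝ) (hWπ : W ξ₈ = π) (hW' : deriv W ξ₈ = 0)
    (hZπ : Z ξ₈ = π) (hZ' : deriv Z ξ₈ = 0) :
    (∀ i : ℕ, 1 ≤ i → i ≤ 6 → iteratedDeriv i U ξ₈ = 0) ∧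
    (∀ i : ℕ, 1 ≤ i → i ≤ 6 → iteratedDeriv i V ξ₈ = 0) ∧
    iteratedDeriv 7 U ξ₈
      = -(45 / 4) * q ξ₈ * iteratedDeriv 2 W ξ₈ * (iteratedDeriv 2 Z ξ₈) ^ 2 ∧
    iteratedDeriv 7 V ξ₈
      = -(45 / 4) * q ξ₈ * (iteratedDeriv 2 W ξ₈) ^ 2 * iteratedDeriv 2 Z ξ₈ ∧
    (∀ i : ℕ, 1 ≤ i → i ≤ 8 → iteratedDeriv i y ξ₈ = 0) ∧
    iteratedDeriv 9 y ξ₈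
      = (315 / 2) * q ξ₈ * (iteratedDeriv 2 W ξ₈) ^ 2 * (iteratedDeriv 2 Z ξ₈) ^ 2 := by
  obtain ⟨sW, cW⟩ := POrd.facts hW hWπ hW'
  obtain ⟨sZ, cZ⟩ := POrd.facts hZ hZπ hZ'
  have Q : POrd ξ₈ 0 q (q ξ₈) := ⟨hq, by simp, by simp⟩
  have Q2 : POrd ξ₈ 0 (fun t => q t / 2) (q ξ₈ / 2) := ⟨hq.div_const 2, by simp, by simp⟩
  obtain ⟨u1, u2⟩ := ((Q2.mul sW).mul cZ).fin hU
  obtain ⟨v1, v2⟩ := ((Q2.mul cW).mul sZ).fin hV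
  obtain ⟨y1, y2⟩ := ((Q.mul cW).mul cZ).fin hy
  refine ⟨u1, v1, u2.trans ?_, v2.trans ?_, y1, y2.trans ?_⟩ <;>
  · simp [Nat.factorial]; ring
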